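/- Let S ⊂ ℝ³ be the 12-element set consisting of all cyclic permutations of the coordinates of (0, ±1, ±φ), where φ = (1+√5)/2 (the vertices of a regular icosahedron, equivalently the face centers of a regular dodecahedron). Then the group of orthogonal linear transformations of ℝ³ mapping S onto itself has exactly 120 elements, and exactly 60 of them have determinant 1. -/

import Mathlib

noncomputable section

/-- The golden ratio. -/
def gold : ℝ := (1 + Real.sqrt 5) / 2

/-- The 12 vertices of a regular icosahedron (face centers of a regular
dodecahedron): all cyclic permutations of the coordinates of `(0, ±1, ±φ)`. -/
def icosa : Set (Fin 3 → ℝ) :=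
  {v | ∃ s t : ℝ, (s = 1 ∨ s = -1) ∧ (t = 1 ∨ t = -1) ∧
    (v = ![0, s, t * gold] ∨ v = ![t * gold, 0, s] ∨ v = ![s, t * gold, 0])}

open scoped Matrix

/-- The ring of golden integers `ℤ[φ]`, with decidable equality. -/
abbrev GInt : Type := QuadraticAlgebra ℤ 1 1

lemma gold_sq : gold * gold = 1 + gold := by
  have h := Real.mul_self_sqrt (show (0 : ℝ) ≤ 5 by norm_num)
  unfold gold
  nlinarith

lemma gold_irrational : Irrational gold := Real.goldenRatio_irrational

/-- Evaluation of golden integers in `ℝ`. -/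
def gev : GInt →+* ℝ where
  toFun z := z.re + z.im * gold
  map_zero' := by simp
  map_one' := by
    rw [QuadraticAlgebra.re_one, QuadraticAlgebra.im_one]; simp
  map_add' z w := by simp; ring
  map_mul' z w := by
    simp
    linear_combination (-(z.im : ℝ) * w.im) * gold_sq

lemma gev_mk (a b : ℤ) : gev ⟨a, b⟩ = a + b * gold := rfl

lemma gev_injective : Function.Injective gev := by
  rw [injective_iff_map_eq_zero]
  rintro ⟨a, b⟩ h
  rw [gev_mk] at h
  have hb : b = 0 := by
    by_contra hb
    have hi := (gold_irrational.intCast_mul hb).intCast_add a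
    rw [h] at hi
    exact not_irrational_zero hi
  subst hb
  have ha : a = 0 := by simpa using h
  subst ha
  rfl

/-- The twelve vertices with golden integer coordinates. -/
def vert : Fin 12 → Fin 3 → GInt :=
  ![![⟨0, 0⟩, ⟨1, 0⟩, ⟨0, 1⟩],
    ![⟨0, 1⟩, ⟨0, 0⟩, ⟨1, 0⟩],
    ![⟨1, 0⟩, ⟨0, 1⟩, ⟨0, 0⟩],
    ![⟨0, 0⟩, ⟨1, 0⟩, ⟨0, -1⟩],
    ![⟨0, -1⟩, ⟨0, 0⟩, ⟨1, 0⟩],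
    ![⟨1, 0⟩, ⟨0, -1⟩, ⟨0, 0⟩],
    ![⟨0, 0⟩, ⟨-1, 0⟩, ⟨0, 1⟩],
    ![⟨0, 1⟩, ⟨0, 0⟩, ⟨-1, 0⟩],
    ![⟨-1, 0⟩, ⟨0, 1⟩, ⟨0, 0⟩],
    ![⟨0, 0⟩, ⟨-1, 0⟩, ⟨0, -1⟩],
    ![⟨0, -1⟩, ⟨0, 0⟩, ⟨-1, 0⟩],
    ![⟨-1, 0⟩, ⟨0, -1⟩, ⟨0, 0⟩]]

/-- Coordinates of the twelve vertices in the basis of the first three. -/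
def coef : Fin 12 → Fin 3 → GInt :=
  ![![⟨1, 0⟩, ⟨0, 0⟩, ⟨0, 0⟩],
    ![⟨0, 0⟩, ⟨1, 0⟩, ⟨0, 0⟩],
    ![⟨0, 0⟩, ⟨0, 0⟩, ⟨1, 0⟩],
    ![⟨1, -1⟩, ⟨1, -1⟩, ⟨1, 0⟩],
    ![⟨1, 0⟩, ⟨1, -1⟩, ⟨1, -1⟩],
    ![⟨1, -1⟩, ⟨1, 0⟩, ⟨1, -1⟩],
    ![⟨-1, 1⟩, ⟨-1, 1⟩, ⟨-1, 0⟩],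
    ![⟨-1, 0⟩, ⟨-1, 1⟩, ⟨-1, 1⟩],
    ![⟨-1, 1⟩, ⟨-1, 0⟩, ⟨-1, 1⟩],
    ![⟨-1, 0⟩, ⟨0, 0⟩, ⟨0, 0⟩],
    ![⟨0, 0⟩, ⟨-1, 0⟩, ⟨0, 0⟩],
    ![⟨0, 0⟩, ⟨0, 0⟩, ⟨-1, 0⟩]]

/-- Triples of vertices. -/
abbrev Trip : Type := Fin 12 × Fin 12 × Fin 12

/-- The matrix whose columns are the vertices of a triple. -/
def tmat (t : Trip) : Matrix (Fin 3) (Fin 3) GInt :=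
  fun i j => vert (![t.1, t.2.1, t.2.2] j) i

/-- The reference triple. -/
def base : Trip := (0, 1, 2)

/-- Explicit dot product. -/
def gdot (u v : Fin 3 → GInt) : GInt := u 0 * v 0 + u 1 * v 1 + u 2 * v 2

/-- Explicit determinant. -/
def gdet (u v w : Fin 3 → GInt) : GInt :=
  u 0 * (v 1 * w 2 - v 2 * w 1) - u 1 * (v 0 * w 2 - v 2 * w 0) + u 2 * (v 0 * w 1 - v 1 * w 0)

/-- Adjacency of vertices, each row being encoded as a bit mask. -/
def adj (a b : Fin 12) : Bool :=
  ((![342, 229, 395, 1924, 3393, 2754, 2099, 558, 1053, 3240, 2840, 1648] : Fin 12 → ℕ) a).testBit b.val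

lemma adj_iff (a b : Fin 12) : adj a b = true ↔ gdot (vert a) (vert b) = ⟨0, 1⟩ := by
  revert a b; decide +kernel

/-- Triples of pairwise adjacent vertices. -/
def faces : Finset Trip := Finset.univ.filter fun t =>
  adj t.1 t.2.1 = true ∧ adj t.1 t.2.2 = true ∧ adj t.2.1 t.2.2 = true

/-- Positively oriented triples of pairwise adjacent vertices. -/
def pfaces : Finset Trip := faces.filter fun t =>
  gdet (vert t.1) (vert t.2.1) (vert t.2.2) = ⟨2, 2⟩

lemma faces_card : faces.card = 120 := by decide +kernel

lemma pfaces_card : pfaces.card = 60 := by decide +kernel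

lemma vert_injective : Function.Injective vert := by
  have : ∀ a b, vert a = vert b → a = b := by decide +kernel
  exact fun a b => this a b

lemma gdot_self (a : Fin 12) : gdot (vert a) (vert a) = ⟨2, 1⟩ := by
  revert a; decide +kernel

lemma coef_spec (k : Fin 12) : tmat base *ᵥ coef k = vert k := by
  revert k; decide +kernel

/-- The antipode of a vertex. -/
def antip : Fin 12 → Fin 12 := ![9, 10, 11, 6, 7, 8, 3, 4, 5, 0, 1, 2]

lemma vert_antip (a : Fin 12) : vert (antip a) = -vert a := by
  revert a; decide +kernel

/-- The two common neighbours of two adjacent vertices have sum proportional to theirs. -/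
lemma common_nbr : ∀ a b : Fin 12, adj a b = true → ∀ c : Fin 12, adj a c = true →
    adj b c = true → ∃ d : Fin 12, (adj a d = true ∧ adj b d = true ∧ d ≠ c) ∧
      ∀ i, vert c i + vert d i = (⟨-1, 1⟩ : GInt) * (vert a i + vert b i) := by
  decide +kernel

lemma adj_symm {a b : Fin 12} (h : adj a b = true) : adj b a = true := by
  rw [adj_iff] at h ⊢
  rw [← h]
  unfold gdot
  ring

lemma faces_closed (t : Trip) (ht : t ∈ faces) (k : Fin 12) : ∃ l : Fin 12, vert l =
    coef k 0 • vert t.1 + coef k 1 • vert t.2.1 + coef k 2 • vert t.2.2 := by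
  obtain ⟨-, h1, h2, h3⟩ := Finset.mem_filter.1 ht
  obtain ⟨a, b, c⟩ := t
  simp only at h1 h2 h3 ⊢
  obtain ⟨x, -, hx⟩ := common_nbr a b h1 c h2 h3
  obtain ⟨y, -, hy⟩ := common_nbr b c h3 a (adj_symm h1) (adj_symm h2)
  obtain ⟨z, -, hz⟩ := common_nbr a c h2 b h1 (adj_symm h3)
  have e1 : (⟨1, 0⟩ : GInt) = 1 := rfl
  have e0 : (⟨0, 0⟩ : GInt) = 0 := rfl
  have en : (⟨-1, 0⟩ : GInt) = -1 := rfl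
  have ep : (⟨1, -1⟩ : GInt) = -⟨-1, 1⟩ := rfl
  generalize hg : (⟨-1, 1⟩ : GInt) = g at hx hy hz ep
  have neg : ∀ l : Fin 12, ∀ i, vert (antip l) i = -vert l i := fun l i => by
    rw [vert_antip]; rfl
  refine ⟨![a, b, c, antip x, antip y, antip z, x, y, z, antip a, antip b, antip c] k, ?_⟩
  funext i
  have hx := hx i
  have hy := hy i
  have hz := hz i
  fin_cases k <;> simp [coef, e1, e0, en, ep, hg, neg]
  · linear_combination -hx
  · linear_combination -hy
  · linear_combination -hz
  · linear_combination hx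
  · linear_combination hy
  · linear_combination hz

lemma det_tmat (t : Trip) :
    (tmat t).det = gdet (vert t.1) (vert t.2.1) (vert t.2.2) := by
  simp [Matrix.det_fin_three, tmat, gdet]
  ring

lemma gram_entry (t : Trip) (i j : Fin 3) : ((tmat t)ᵀ * tmat t) i j =
    gdot (vert (![t.1, t.2.1, t.2.2] i)) (vert (![t.1, t.2.1, t.2.2] j)) := by
  simp [Matrix.mul_apply, Fin.sum_univ_three, tmat, gdot]

/-- The real vertices. -/
def rvert (k : Fin 12) : Fin 3 → ℝ := fun i => gev (vert k i)

lemma rvert_injective : Function.Injective rvert := by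
  intro a b h
  apply vert_injective
  funext i
  exact gev_injective (congrFun h i)

lemma icosa_eq : icosa = Set.range rvert := by
  ext v
  constructor
  · rintro ⟨s, t, rfl | rfl, rfl | rfl, rfl | rfl | rfl⟩
    · exact ⟨0, by funext i; fin_cases i <;> simp [rvert, vert, gev_mk]⟩
    · exact ⟨1, by funext i; fin_cases i <;> simp [rvert, vert, gev_mk]⟩
    · exact ⟨2, by funext i; fin_cases i <;> simp [rvert, vert, gev_mk]⟩
    · exact ⟨3, by funext i; fin_cases i <;> simp [rvert, vert, gev_mk]⟩
    · exact ⟨4, by funext i; fin_cases i <;> simp [rvert, vert, gev_mk]⟩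
    · exact ⟨5, by funext i; fin_cases i <;> simp [rvert, vert, gev_mk]⟩
    · exact ⟨6, by funext i; fin_cases i <;> simp [rvert, vert, gev_mk]⟩
    · exact ⟨7, by funext i; fin_cases i <;> simp [rvert, vert, gev_mk]⟩
    · exact ⟨8, by funext i; fin_cases i <;> simp [rvert, vert, gev_mk]⟩
    · exact ⟨9, by funext i; fin_cases i <;> simp [rvert, vert, gev_mk]⟩
    · exact ⟨10, by funext i; fin_cases i <;> simp [rvert, vert, gev_mk]⟩
    · exact ⟨11, by funext i; fin_cases i <;> simp [rvert, vert, gev_mk]⟩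
  · rintro ⟨k, rfl⟩
    have key : ∀ k : Fin 12, ∃ s t : ℤ, (s = 1 ∨ s = -1) ∧ (t = 1 ∨ t = -1) ∧
        (vert k = ![0, ⟨s, 0⟩, ⟨0, t⟩] ∨ vert k = ![⟨0, t⟩, 0, ⟨s, 0⟩] ∨
          vert k = ![⟨s, 0⟩, ⟨0, t⟩, 0]) := by
      have : ∀ k : Fin 12, ∃ s ∈ ({1, -1} : Finset ℤ), ∃ t ∈ ({1, -1} : Finset ℤ),
        (vert k = ![0, ⟨s, 0⟩, ⟨0, t⟩] ∨ vert k = ![⟨0, t⟩, 0, ⟨s, 0⟩] ∨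
          vert k = ![⟨s, 0⟩, ⟨0, t⟩, 0]) := by decide +kernel
      intro k
      obtain ⟨s, hs, t, ht, h⟩ := this k
      exact ⟨s, t, by simpa using hs, by simpa using ht, h⟩
    obtain ⟨s, t, hs, ht, h⟩ := key k
    refine ⟨s, t, by exact_mod_cast hs, by exact_mod_cast ht, ?_⟩
    rcases h with h | h | h
    · left
      funext i; fin_cases i <;> simp [rvert, h, gev_mk]
    · right; left
      funext i; fin_cases i <;> simp [rvert, h, gev_mk]
    · right; right
      funext i; fin_cases i <;> simp [rvert, h, gev_mk]

/-- The real matrix of a triple. -/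
def rmat (t : Trip) : Matrix (Fin 3) (Fin 3) ℝ := (tmat t).map gev

lemma det_rmat (t : Trip) : (rmat t).det = gev (tmat t).det :=
  (RingHom.map_det gev (tmat t)).symm

lemma det_base : (tmat base).det = ⟨2, 2⟩ := by
  rw [det_tmat]; decide +kernel

lemma base_unit : IsUnit (rmat base).det := by
  rw [isUnit_iff_ne_zero, det_rmat, det_base]
  intro h
  rw [map_eq_zero_iff _ gev_injective] at h
  exact absurd h (by decide)

lemma gram_eq {t : Trip} (ht : t ∈ faces) : (tmat t)ᵀ * tmat t = (tmat base)ᵀ * tmat base := by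
  have hb : base ∈ faces := by decide +kernel
  have comm : ∀ u v, gdot u v = gdot v u := fun u v => by unfold gdot; ring
  have gram : ∀ s ∈ faces, ∀ i j, ((tmat s)ᵀ * tmat s) i j = if i = j then ⟨2, 1⟩ else ⟨0, 1⟩ := by
    intro s hs i j
    obtain ⟨-, h1, h2, h3⟩ := Finset.mem_filter.1 hs
    rw [adj_iff] at h1 h2 h3
    rw [gram_entry]
    fin_cases i <;> fin_cases j <;>
      simp [gdot_self, h1, h2, h3, comm (vert s.2.1) (vert s.1), comm (vert s.2.2) (vert s.1),
        comm (vert s.2.2) (vert s.2.1)]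
  ext1 i j
  rw [gram t ht, gram base hb]

lemma rgram_eq {t : Trip} (ht : t ∈ faces) : (rmat t)ᵀ * rmat t = (rmat base)ᵀ * rmat base := by
  have h := congrArg (fun M => M.map gev) (gram_eq ht)
  simpa [Matrix.map_mul, Matrix.transpose_map, rmat] using h

/-- The property of being an orthogonal map preserving the icosahedron. -/
def IsSym (f : (Fin 3 → ℝ) →ₗ[ℝ] (Fin 3 → ℝ)) : Prop :=
  (∀ v w : Fin 3 → ℝ, ∑ i, f v i * f w i = ∑ i, v i * w i) ∧ f '' icosa = icosa

/-- `f` sends the base triple to the triple `t`. -/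
def Sends (f : (Fin 3 → ℝ) →ₗ[ℝ] (Fin 3 → ℝ)) (t : Trip) : Prop :=
  LinearMap.toMatrix' f * rmat base = rmat t

lemma sends_iff (f : (Fin 3 → ℝ) →ₗ[ℝ] (Fin 3 → ℝ)) (t : Trip) :
    Sends f t ↔ f (rvert 0) = rvert t.1 ∧ f (rvert 1) = rvert t.2.1 ∧
      f (rvert 2) = rvert t.2.2 := by
  have hcol : ∀ s : Trip, ∀ j, (fun i => rmat s i j) = rvert (![s.1, s.2.1, s.2.2] j) :=
    fun s j => rfl
  have hmul : ∀ j, (fun i => (LinearMap.toMatrix' f * rmat base) i j) =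
      f (rvert (![0, 1, 2] j)) := by
    intro j
    rw [← LinearMap.toMatrix'_mulVec f]
    rfl
  have h3 : Sends f t ↔ ∀ j, f (rvert (![0, 1, 2] j)) = rvert (![t.1, t.2.1, t.2.2] j) := by
    constructor
    · intro h j
      rw [← hmul, ← hcol, h]
    · intro h
      ext i j
      have := h j
      rw [← hmul, ← hcol] at this
      exact congrFun this i
  rw [h3, Fin.forall_fin_succ, Fin.forall_fin_two]
  rfl

lemma sends_unique_map {f g : (Fin 3 → ℝ) →ₗ[ℝ] (Fin 3 → ℝ)} {t : Trip}
    (hf : Sends f t) (hg : Sends g t) : f = g := by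
  have h : LinearMap.toMatrix' f * rmat base = LinearMap.toMatrix' g * rmat base :=
    hf.trans hg.symm
  have h2 := congrArg (fun M => M * (rmat base)⁻¹) h
  simp only [Matrix.mul_nonsing_inv_cancel_right _ _ base_unit] at h2
  exact LinearMap.toMatrix'.injective h2

lemma sends_unique_trip {f : (Fin 3 → ℝ) →ₗ[ℝ] (Fin 3 → ℝ)} {s t : Trip}
    (hf : Sends f s) (hg : Sends f t) : s = t := by
  rw [sends_iff] at hf hg
  obtain ⟨a, b, c⟩ := s
  obtain ⟨a', b', c'⟩ := t
  simp only [Prod.mk.injEq]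
  exact ⟨rvert_injective (hf.1.symm.trans hg.1), rvert_injective (hf.2.1.symm.trans hg.2.1),
    rvert_injective (hf.2.2.symm.trans hg.2.2)⟩

lemma rdot (a b : Fin 12) : ∑ i, rvert a i * rvert b i = gev (gdot (vert a) (vert b)) := by
  simp [Fin.sum_univ_three, rvert, gdot]

lemma sym_sends {f : (Fin 3 → ℝ) →ₗ[ℝ] (Fin 3 → ℝ)} (hf : IsSym f) :
    ∃ t ∈ faces, Sends f t := by
  obtain ⟨ho, hi⟩ := hf
  have hm : ∀ k, ∃ l, f (rvert k) = rvert l := by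
    intro k
    have : f (rvert k) ∈ icosa := by
      rw [← hi]
      exact ⟨_, by rw [icosa_eq]; exact ⟨k, rfl⟩, rfl⟩
    rw [icosa_eq] at this
    obtain ⟨l, hl⟩ := this
    exact ⟨l, hl.symm⟩
  choose σ hσ using hm
  have hd : ∀ a b, gdot (vert (σ a)) (vert (σ b)) = gdot (vert a) (vert b) := by
    intro a b
    apply gev_injective
    rw [← rdot, ← rdot, ← hσ, ← hσ, ho]
  refine ⟨(σ 0, σ 1, σ 2), ?_, ?_⟩
  · refine Finset.mem_filter.2 ⟨Finset.mem_univ _, ?_⟩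
    simp only [adj_iff, hd]
    decide +kernel
  · rw [sends_iff]
    exact ⟨hσ 0, hσ 1, hσ 2⟩

lemma rvert_coef (k : Fin 12) : rvert k = gev (coef k 0) • rvert 0 + gev (coef k 1) • rvert 1 +
    gev (coef k 2) • rvert 2 := by
  funext i
  have h := congrArg gev (congrFun (coef_spec k) i)
  simp [Matrix.mulVec, dotProduct, Fin.sum_univ_three, tmat, base] at h
  simp [rvert, ← h]
  ring

lemma face_sym {t : Trip} (ht : t ∈ faces) :
    ∃ f : (Fin 3 → ℝ) →ₗ[ℝ] (Fin 3 → ℝ), IsSym f ∧ Sends f t := by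
  set M : Matrix (Fin 3) (Fin 3) ℝ := rmat t * (rmat base)⁻¹ with hM
  have hs : Sends (Matrix.toLin' M) t := by
    unfold Sends
    rw [LinearMap.toMatrix'_toLin', hM, Matrix.nonsing_inv_mul_cancel_right _ _ base_unit]
  have horth : Mᵀ * M = 1 := by
    rw [hM, Matrix.transpose_mul, Matrix.mul_assoc, ← Matrix.mul_assoc (rmat t)ᵀ, rgram_eq ht,
      Matrix.mul_assoc, Matrix.mul_nonsing_inv _ base_unit, Matrix.mul_one,
      ← Matrix.transpose_mul, Matrix.mul_nonsing_inv _ base_unit, Matrix.transpose_one]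
  refine ⟨Matrix.toLin' M, ⟨?_, ?_⟩, hs⟩
  · intro v w
    change (M *ᵥ v) ⬝ᵥ (M *ᵥ w) = v ⬝ᵥ w
    rw [Matrix.dotProduct_mulVec, ← Matrix.mulVec_transpose, Matrix.mulVec_mulVec, horth,
      Matrix.one_mulVec]
  · have hinj : Function.Injective (Matrix.toLin' M) := by
      intro v w h
      have h2 : Mᵀ *ᵥ (M *ᵥ v) = Mᵀ *ᵥ (M *ᵥ w) := congrArg (fun x => Mᵀ *ᵥ x) h
      simpa [Matrix.mulVec_mulVec, horth] using h2
    have hfin : icosa.Finite := by rw [icosa_eq]; exact Set.finite_range _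
    have hsub : Matrix.toLin' M '' icosa ⊆ icosa := by
      rw [icosa_eq]
      rintro _ ⟨_, ⟨k, rfl⟩, rfl⟩
      obtain ⟨l, hl⟩ := faces_closed t ht k
      refine ⟨l, ?_⟩
      obtain ⟨h0, h1, h2⟩ := (sends_iff _ _).1 hs
      rw [rvert_coef k, map_add, map_add, map_smul, map_smul, map_smul, h0, h1, h2]
      funext i
      have := congrArg gev (congrFun hl i)
      simpa [rvert] using this
    exact Set.eq_of_subset_of_ncard_le hsub (Set.ncard_image_of_injective _ hinj).ge hfin

lemma det_sends {f : (Fin 3 → ℝ) →ₗ[ℝ] (Fin 3 → ℝ)} {t : Trip} (hf : Sends f t) :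
    LinearMap.det f = 1 ↔ gdet (vert t.1) (vert t.2.1) (vert t.2.2) = ⟨2, 2⟩ := by
  have h := congrArg Matrix.det hf
  rw [Matrix.det_mul, LinearMap.det_toMatrix'] at h
  rw [← det_tmat, ← det_base, ← gev_injective.eq_iff, ← det_rmat, ← det_rmat, ← h]
  constructor
  · intro h1; rw [h1, one_mul]
  · intro h1
    exact mul_right_cancel₀ base_unit.ne_zero (h1.trans (one_mul _).symm)

lemma count (A : Set ((Fin 3 → ℝ) →ₗ[ℝ] (Fin 3 → ℝ))) (F : Finset Trip)
    (h1 : ∀ f ∈ A, ∃ t ∈ F, Sends f t) (h2 : ∀ t ∈ F, ∃ f ∈ A, Sends f t) :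
    A.ncard = F.card := by
  rw [← Set.ncard_coe_finset]
  choose! g hg using h1
  refine Set.ncard_congr (fun f _ => g f) (fun f hf => (hg f hf).1) ?_ ?_
  · intro f f' hf hf' h
    have a := (hg f hf).2
    have b := (hg f' hf').2
    rw [← h] at b
    exact sends_unique_map a b
  · intro t ht
    obtain ⟨f, hf, hs⟩ := h2 t ht
    exact ⟨f, hf, sends_unique_trip (hg f hf).2 hs⟩

/-- The group of orthogonal linear transformations of `ℝ³` preserving the
icosahedron has 120 elements, 60 of them of determinant 1. -/
theorem dodecahedron_symmetry_count :
    Set.ncard {f : (Fin 3 → ℝ) →ₗ[ℝ] (Fin 3 → ℝ) |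
      (∀ v w : Fin 3 → ℝ, ∑ i, f v i * f w i = ∑ i, v i * w i) ∧
      f '' icosa = icosa} = 120 ∧
    Set.ncard {f : (Fin 3 → ℝ) →ₗ[ℝ] (Fin 3 → ℝ) |
      (∀ v w : Fin 3 → ℝ, ∑ i, f v i * f w i = ∑ i, v i * w i) ∧
      f '' icosa = icosa ∧ LinearMap.det f = 1} = 60 := by
  constructor
  · rw [← faces_card]
    refine count _ _ (fun f hf => sym_sends hf) (fun t ht => ?_)
    obtain ⟨f, hf, hs⟩ := face_sym ht
    exact ⟨f, hf, hs⟩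
  · rw [← pfaces_card]
    refine count _ _ (fun f hf => ?_) (fun t ht => ?_)
    · obtain ⟨t, ht, hs⟩ := sym_sends ⟨hf.1, hf.2.1⟩
      exact ⟨t, Finset.mem_filter.2 ⟨ht, (det_sends hs).1 hf.2.2⟩, hs⟩
    · obtain ⟨ht, hd⟩ := Finset.mem_filter.1 ht
      obtain ⟨f, hf, hs⟩ := face_sym ht
      exact ⟨f, ⟨hf.1, hf.2, (det_sends hs).2 hd⟩, hs⟩
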